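/- arXiv:2602.11035 — 2 statements merged into one kernel-verified Lean document; each statement's English description precedes it below -/
import Mathlib

section
/- Every preprocessed term rewrites to its normal form: for every t ∈ pp(Σ), t rewrites to NF(t) in zero or more R-steps. -/
/-- Terms over a signature `G` of generators: identities, generators,
sequential composition `⨟` and parallel composition `⊗`. -/
inductive PTerm (G : Type) : Type where
  | id : ℕ → PTerm G
  | gen : G → PTerm G
  | seq : PTerm G → PTerm G → PTerm G
  | par : PTerm G → PTerm G → PTerm G

namespace PTerm

variable {G : Type}

/-- Domain of a term. -/
def dom (domG : G → ℕ) : PTerm G → ℕ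
  | .id n => n
  | .gen g => domG g
  | .seq u _ => u.dom domG
  | .par u v => u.dom domG + v.dom domG

/-- Codomain of a term. -/
def cod (codG : G → ℕ) : PTerm G → ℕ
  | .id n => n
  | .gen g => codG g
  | .seq _ v => v.cod codG
  | .par u v => u.cod codG + v.cod codG

/-- Well-typedness of a term. -/
def WT (domG codG : G → ℕ) : PTerm G → Prop
  | .id _ => True
  | .gen _ => True
  | .seq u v => WT domG codG u ∧ WT domG codG v ∧ u.cod codG = v.dom domG
  | .par u v => WT domG codG u ∧ WT domG codG v

end PTerm

/-- A layer `⟨k, g, ℓ⟩ = id_k ⊗ (g ⊗ id_ℓ)`. -/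
def layer {G : Type} (k : ℕ) (g : G) (ℓ : ℕ) : PTerm G :=
  .par (.id k) (.par (.gen g) (.id ℓ))

/-- The set `pp(Σ)` of preprocessed terms: the smallest set of well-typed terms
containing all identities and all layers and closed under `⨟` and `⊗`. -/
inductive PP {G : Type} (domG codG : G → ℕ) : PTerm G → Prop where
  | protected id (n : ℕ) : PP domG codG (.id n)
  | protected layer (k : ℕ) (g : G) (ℓ : ℕ) : PP domG codG (layer k g ℓ)
  | protected seq {u v : PTerm G} : PP domG codG u → PP domG codG v →
      u.cod codG = v.dom domG → PP domG codG (.seq u v)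
  | protected par {u v : PTerm G} : PP domG codG u → PP domG codG v →
      PP domG codG (.par u v)

/-- `NFSeq domG codG h t` : `t` is a well-typed sequence of layers in normal form whose
first layer `⟨k₁, g₁, ℓ₁⟩` has height `h = k₁ + dom g₁`. -/
inductive NFSeq {G : Type} (domG codG : G → ℕ) : ℕ → PTerm G → Prop where
  | single (k : ℕ) (g : G) (ℓ : ℕ) : NFSeq domG codG (k + domG g) (layer k g ℓ)
  | cons (k : ℕ) (g : G) (ℓ : ℕ) {h : ℕ} {t : PTerm G} :
      NFSeq domG codG h t → k < h →
      (layer k g ℓ : PTerm G).cod codG = t.dom domG →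
      NFSeq domG codG (k + domG g) (.seq (layer k g ℓ) t)

/-- The set `NF(Σ)` of terms in normal form. -/
def IsNF {G : Type} (domG codG : G → ℕ) (t : PTerm G) : Prop :=
  (∃ n, t = .id n) ∨ ∃ h, NFSeq domG codG h t

/-- Inserting a single layer `⟨k', g', ℓ'⟩` into a sequence of layers:
the single-layer case of the `•` operation of Definition 2. -/
def insertLayer {G : Type} (domG codG : G → ℕ) (k' : ℕ) (g' : G) (ℓ' : ℕ) :
    List (ℕ × G × ℕ) → List (ℕ × G × ℕ)
  | [] => [(k', g', ℓ')]
  | (k, g, ℓ) :: rest =>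
      if k' < k + domG g then (k', g', ℓ') :: (k, g, ℓ) :: rest
      else (k, g, ℓ + codG g' - domG g') ::
        insertLayer domG codG (k' + domG g - codG g) g' ℓ' rest

/-- The `•` operation of Definition 2 on layer sequences. -/
def bulletList {G : Type} (domG codG : G → ℕ)
    (ls rs : List (ℕ × G × ℕ)) : List (ℕ × G × ℕ) :=
  ls.foldr (fun l acc => insertLayer domG codG l.1 l.2.1 l.2.2 acc) rs

/-- Representation of normal forms: an identity or a (nonempty) sequence of layers,
each layer given by its upper width, generator and lower width. -/
inductive NFRep (G : Type) : Type where
  | id : ℕ → NFRep G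
  | seq : List (ℕ × G × ℕ) → NFRep G

/-- Domain of a sequence of layers. -/
def listDom {G : Type} (domG : G → ℕ) : List (ℕ × G × ℕ) → ℕ
  | [] => 0
  | (k, g, ℓ) :: _ => k + domG g + ℓ

/-- Codomain of a sequence of layers. -/
def listCod {G : Type} (codG : G → ℕ) : List (ℕ × G × ℕ) → ℕ
  | [] => 0
  | [(k, g, ℓ)] => k + codG g + ℓ
  | _ :: rest => listCod codG rest

/-- The `•` operation of Definition 2. -/
def bullet {G : Type} (domG codG : G → ℕ) : NFRep G → NFRep G → NFRep G
  | .id n, .id _ => .id n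
  | .id _, .seq rs => .seq rs
  | .seq ls, .id _ => .seq ls
  | .seq ls, .seq rs => .seq (bulletList domG codG ls rs)

/-- The `⋆` operation of Definition 2. -/
def star {G : Type} (domG codG : G → ℕ) : NFRep G → NFRep G → NFRep G
  | .id n, .id m => .id (n + m)
  | .id n, .seq rs => .seq (rs.map (fun l => (l.1 + n, l.2.1, l.2.2)))
  | .seq ls, .id n => .seq (ls.map (fun l => (l.1, l.2.1, l.2.2 + n)))
  | .seq ls, .seq rs =>
      .seq (ls.map (fun l => (l.1, l.2.1, l.2.2 + listDom domG rs)) ++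
            rs.map (fun l => (l.1 + listCod codG ls, l.2.1, l.2.2)))

/-- The normalizing map, on representations. -/
def NFr {G : Type} (domG codG : G → ℕ) : PTerm G → NFRep G
  | .id n => .id n
  | .gen g => .seq [(0, g, 0)]
  | .seq u v => bullet domG codG (NFr domG codG u) (NFr domG codG v)
  | .par u v => star domG codG (NFr domG codG u) (NFr domG codG v)

/-- Turning a sequence of layers back into a term. -/
def layersToTerm {G : Type} : List (ℕ × G × ℕ) → PTerm G
  | [] => .id 0
  | [(k, g, ℓ)] => layer k g ℓ
  | (k, g, ℓ) :: rest => .seq (layer k g ℓ) (layersToTerm rest)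

/-- The normalizing map `NF : terms → NF(Σ)` of Definition 2. -/
def NFmap {G : Type} (domG codG : G → ℕ) (t : PTerm G) : PTerm G :=
  match NFr domG codG t with
  | .id n => .id n
  | .seq ls => layersToTerm ls

/-- One-step rewriting with the TRS `R` (rules R1–R11, closed under subterm contexts).
The integer quantities `ℓ₂ + def g₁` and `k₁ - def g₂` of rules R10/R11 are written with
truncated subtraction; they agree with the intended values on well-typed terms. -/
inductive Step {G : Type} (domG codG : G → ℕ) : PTerm G → PTerm G → Prop where
  | r1 (t u v : PTerm G) : Step domG codG (.seq (.seq t u) v) (.seq t (.seq u v))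
  | r2 (t u v : PTerm G) : Step domG codG (.par (.par t u) v) (.par t (.par u v))
  | r3 (n : ℕ) (t : PTerm G) : Step domG codG (.seq (.id n) t) t
  | r4 (n : ℕ) (t : PTerm G) : Step domG codG (.seq t (.id n)) t
  | r5 (n m : ℕ) : Step domG codG (.par (.id n) (.id m)) (.id (n + m))
  | r6 (n m : ℕ) (t : PTerm G) :
      Step domG codG (.par (.id n) (.par (.id m) t)) (.par (.id (n + m)) t)
  | r7 (u v : PTerm G) : (∀ n, u ≠ .id n) → (∀ n, v ≠ .id n) →
      Step domG codG (.par u v)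
        (.seq (.par u (.id (v.dom domG))) (.par (.id (u.cod codG)) v))
  | r8 (n : ℕ) (u v : PTerm G) :
      Step domG codG (.par (.id n) (.seq u v))
        (.seq (.par (.id n) u) (.par (.id n) v))
  | r9 (n : ℕ) (u v : PTerm G) :
      Step domG codG (.par (.seq u v) (.id n))
        (.seq (.par u (.id n)) (.par v (.id n)))
  | r10 (k₁ k₂ ℓ₁ ℓ₂ : ℕ) (g₁ g₂ : G) (h : k₁ ≥ k₂ + domG g₂) :
      Step domG codG (.seq (layer k₁ g₁ ℓ₁) (layer k₂ g₂ ℓ₂))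
        (.seq (layer k₂ g₂ (ℓ₂ + codG g₁ - domG g₁))
              (layer (k₁ + domG g₂ - codG g₂) g₁ ℓ₁))
  | r11 (k₁ k₂ ℓ₁ ℓ₂ : ℕ) (g₁ g₂ : G) (t : PTerm G) (h : k₁ ≥ k₂ + domG g₂) :
      Step domG codG (.seq (layer k₁ g₁ ℓ₁) (.seq (layer k₂ g₂ ℓ₂) t))
        (.seq (layer k₂ g₂ (ℓ₂ + codG g₁ - domG g₁))
              (.seq (layer (k₁ + domG g₂ - codG g₂) g₁ ℓ₁) t))
  | seqL {u u' : PTerm G} (v : PTerm G) :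
      Step domG codG u u' → Step domG codG (.seq u v) (.seq u' v)
  | seqR (u : PTerm G) {v v' : PTerm G} :
      Step domG codG v v' → Step domG codG (.seq u v) (.seq u v')
  | parL {u u' : PTerm G} (v : PTerm G) :
      Step domG codG u u' → Step domG codG (.par u v) (.par u' v)
  | parR (u : PTerm G) {v v' : PTerm G} :
      Step domG codG v v' → Step domG codG (.par u v) (.par u v')

/-- Zero or more rewrite steps of `R`. -/
def Steps {G : Type} (domG codG : G → ℕ) : PTerm G → PTerm G → Prop :=
  Relation.ReflTransGen (Step domG codG)

/-- Provable equality in the PRO `PRO_Σ`: the smallest congruence (for `⨟` and `⊗`)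
containing the PRO coherence equations. -/
inductive ProEq {G : Type} (domG codG : G → ℕ) : PTerm G → PTerm G → Prop where
  | refl (t : PTerm G) : ProEq domG codG t t
  | symm {t u : PTerm G} : ProEq domG codG t u → ProEq domG codG u t
  | trans {t u v : PTerm G} :
      ProEq domG codG t u → ProEq domG codG u v → ProEq domG codG t v
  | seqCongr {u u' v v' : PTerm G} : ProEq domG codG u u' → ProEq domG codG v v' →
      ProEq domG codG (.seq u v) (.seq u' v')
  | parCongr {u u' v v' : PTerm G} : ProEq domG codG u u' → ProEq domG codG v v' →
      ProEq domG codG (.par u v) (.par u' v')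
  | seqAssoc (t u v : PTerm G) :
      ProEq domG codG (.seq (.seq t u) v) (.seq t (.seq u v))
  | seqIdLeft (t : PTerm G) : ProEq domG codG (.seq (.id (t.dom domG)) t) t
  | seqIdRight (t : PTerm G) : ProEq domG codG (.seq t (.id (t.cod codG))) t
  | parAssoc (t u v : PTerm G) :
      ProEq domG codG (.par (.par t u) v) (.par t (.par u v))
  | parIdLeft (t : PTerm G) : ProEq domG codG (.par (.id 0) t) t
  | parIdRight (t : PTerm G) : ProEq domG codG (.par t (.id 0)) t
  | idId (n m : ℕ) : ProEq domG codG (.par (.id n) (.id m)) (.id (n + m))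
  | interchange (u v u' v' : PTerm G) :
      ProEq domG codG (.par (.seq u v) (.seq u' v')) (.seq (.par u u') (.par v v'))

/-- The termination measure `β`. -/
def beta {G : Type} : PTerm G → ℕ
  | .id _ => 2
  | .gen _ => 5
  | .seq u v => 2 * beta u + beta v + 1
  | .par u v => beta u ^ 2 * beta v

/-- The termination measure `δ_D`. -/
noncomputable def delta {G : Type} (D : ℕ) : PTerm G → ℝ
  | .id _ => 0
  | .gen _ => 0
  | .seq u v => delta D u + delta D v / D
  | .par (.id n) v => (n : ℝ) + delta D v
  | .par (.gen g) v => delta D (.gen g) + delta D v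
  | .par (.seq u₁ u₂) v => delta D (.seq u₁ u₂) + delta D v
  | .par (.par u₁ u₂) v => delta D (.par u₁ u₂) + delta D v
  termination_by t => sizeOf t
  decreasing_by all_goals (simp_wf <;> omega)

/-- `D(t) = 2 + max_{g ∈ gen(t)} |def(g)|` (and `2` if no generator occurs in `t`). -/
def Dbound {G : Type} (domG codG : G → ℕ) : PTerm G → ℕ
  | .id _ => 2
  | .gen g => 2 + ((codG g : ℤ) - (domG g : ℤ)).natAbs
  | .seq u v => max (Dbound domG codG u) (Dbound domG codG v)
  | .par u v => max (Dbound domG codG u) (Dbound domG codG v)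

section RewritesToNF

variable {G : Type} {domG codG : G → ℕ}

theorem Step.steps {u v : PTerm G} (h : Step domG codG u v) : Steps domG codG u v :=
  Relation.ReflTransGen.single h

theorem Steps.refl (u : PTerm G) : Steps domG codG u u :=
  Relation.ReflTransGen.refl

theorem Steps.trans {t u v : PTerm G} (h : Steps domG codG t u) (h' : Steps domG codG u v) :
    Steps domG codG t v :=
  Relation.ReflTransGen.trans h h'

theorem Steps.seq {u u' v v' : PTerm G} (hu : Steps domG codG u u')
    (hv : Steps domG codG v v') : Steps domG codG (.seq u v) (.seq u' v') :=
  (Relation.ReflTransGen.lift (PTerm.seq · v) (fun _ _ h => Step.seqL v h) _ _ hu).trans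
    (Relation.ReflTransGen.lift (PTerm.seq u') (fun _ _ h => Step.seqR u' h) _ _ hv)

theorem Steps.par {u u' v v' : PTerm G} (hu : Steps domG codG u u')
    (hv : Steps domG codG v v') : Steps domG codG (.par u v) (.par u' v') :=
  (Relation.ReflTransGen.lift (PTerm.par · v) (fun _ _ h => Step.parL v h) _ _ hu).trans
    (Relation.ReflTransGen.lift (PTerm.par u') (fun _ _ h => Step.parR u' h) _ _ hv)

theorem layersToTerm_cons (k : ℕ) (g : G) (ℓ : ℕ) {r : List (ℕ × G × ℕ)} (hr : r ≠ []) :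
    layersToTerm ((k, g, ℓ) :: r) = .seq (layer k g ℓ) (layersToTerm r) := by
  cases r with
  | nil => exact absurd rfl hr
  | cons => rfl

theorem layersToTerm_ne_id {ls : List (ℕ × G × ℕ)} (h : ls ≠ []) (n : ℕ) :
    layersToTerm ls ≠ .id n := by
  match ls, h with
  | [_], _ => simp [layersToTerm, layer]
  | _ :: _ :: _, _ => simp [layersToTerm]

theorem dom_layersToTerm (ls : List (ℕ × G × ℕ)) :
    (layersToTerm ls).dom domG = listDom domG ls := by
  match ls with
  | [] => rfl
  | [(k, g, ℓ)] => simp [layersToTerm, layer, PTerm.dom, listDom, add_assoc]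
  | (k, g, ℓ) :: _ :: _ => simp [layersToTerm, layer, PTerm.dom, listDom, add_assoc]

theorem cod_layersToTerm (ls : List (ℕ × G × ℕ)) :
    (layersToTerm ls).cod codG = listCod codG ls := by
  match ls with
  | [] => rfl
  | [(k, g, ℓ)] => simp [layersToTerm, layer, PTerm.cod, listCod, add_assoc]
  | (k, g, ℓ) :: b :: r =>
    simpa [layersToTerm, PTerm.cod, listCod] using cod_layersToTerm (b :: r)

theorem insertLayer_ne_nil (k : ℕ) (g : G) (ℓ : ℕ) (ls : List (ℕ × G × ℕ)) :
    insertLayer domG codG k g ℓ ls ≠ [] := by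
  cases ls with
  | nil => simp [insertLayer]
  | cons => unfold insertLayer; split <;> simp

theorem bulletList_ne_nil {ls rs : List (ℕ × G × ℕ)} (h : ls ≠ []) :
    bulletList domG codG ls rs ≠ [] := by
  cases ls with
  | nil => exact absurd rfl h
  | cons => exact insertLayer_ne_nil _ _ _ _

theorem steps_insertLayer (k : ℕ) (g : G) (ℓ : ℕ) {rs : List (ℕ × G × ℕ)} (h : rs ≠ []) :
    Steps domG codG (.seq (layer k g ℓ) (layersToTerm rs))
      (layersToTerm (insertLayer domG codG k g ℓ rs)) := by
  induction rs generalizing k with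
  | nil => exact absurd rfl h
  | cons a r ih =>
    obtain ⟨k₂, g₂, ℓ₂⟩ := a
    by_cases hlt : k < k₂ + domG g₂
    · rw [insertLayer, if_pos hlt]
      exact Steps.refl _
    · rw [insertLayer, if_neg hlt, layersToTerm_cons _ _ _ (insertLayer_ne_nil _ _ _ _)]
      by_cases hr : r = []
      · subst hr
        exact (Step.r10 _ _ _ _ _ _ (not_lt.mp hlt)).steps
      · rw [layersToTerm_cons _ _ _ hr]
        exact (Step.r11 _ _ _ _ _ _ _ (not_lt.mp hlt)).steps.trans
          ((Steps.refl _).seq (ih _ hr))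

theorem steps_bulletList {ls rs : List (ℕ × G × ℕ)} (hl : ls ≠ []) (hr : rs ≠ []) :
    Steps domG codG (.seq (layersToTerm ls) (layersToTerm rs))
      (layersToTerm (bulletList domG codG ls rs)) := by
  induction ls with
  | nil => exact absurd rfl hl
  | cons a r ih =>
    obtain ⟨k, g, ℓ⟩ := a
    by_cases h : r = []
    · subst h
      exact steps_insertLayer k g ℓ hr
    · rw [layersToTerm_cons _ _ _ h]
      exact (Step.r1 _ _ _).steps.trans (((Steps.refl _).seq (ih h)).trans
        (steps_insertLayer k g ℓ (bulletList_ne_nil h)))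

theorem steps_append {ls rs : List (ℕ × G × ℕ)} (hl : ls ≠ []) (hr : rs ≠ []) :
    Steps domG codG (.seq (layersToTerm ls) (layersToTerm rs)) (layersToTerm (ls ++ rs)) := by
  induction ls with
  | nil => exact absurd rfl hl
  | cons a r ih =>
    obtain ⟨k, g, ℓ⟩ := a
    rw [List.cons_append, layersToTerm_cons _ _ _ (List.append_ne_nil_of_right_ne_nil _ hr)]
    by_cases h : r = []
    · subst h
      exact Steps.refl _
    · rw [layersToTerm_cons _ _ _ h]
      exact (Step.r1 _ _ _).steps.trans ((Steps.refl _).seq (ih h))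

theorem steps_id_par_layer (n k : ℕ) (g : G) (ℓ : ℕ) :
    Steps domG codG (.par (.id n) (layer k g ℓ)) (layer (k + n) g ℓ) := by
  rw [add_comm k n]
  exact (Step.r6 _ _ _).steps

theorem steps_layer_par_id (k : ℕ) (g : G) (ℓ n : ℕ) :
    Steps domG codG (.par (layer k g ℓ) (.id n)) (layer k g (ℓ + n)) :=
  (Step.r2 _ _ _).steps.trans ((Steps.refl _).par
    ((Step.r2 _ _ _).steps.trans ((Steps.refl _).par (Step.r5 _ _).steps)))

theorem steps_id_par_layersToTerm (n : ℕ) {rs : List (ℕ × G × ℕ)} (hr : rs ≠ []) :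
    Steps domG codG (.par (.id n) (layersToTerm rs))
      (layersToTerm (rs.map (fun l => (l.1 + n, l.2.1, l.2.2)))) := by
  induction rs with
  | nil => exact absurd rfl hr
  | cons a r ih =>
    obtain ⟨k, g, ℓ⟩ := a
    by_cases h : r = []
    · subst h
      exact steps_id_par_layer n k g ℓ
    · rw [List.map_cons, layersToTerm_cons _ _ _ h, layersToTerm_cons _ _ _ (by simpa using h)]
      exact (Step.r8 _ _ _).steps.trans ((steps_id_par_layer n k g ℓ).seq (ih h))

theorem steps_layersToTerm_par_id {ls : List (ℕ × G × ℕ)} (hl : ls ≠ []) (n : ℕ) :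
    Steps domG codG (.par (layersToTerm ls) (.id n))
      (layersToTerm (ls.map (fun l => (l.1, l.2.1, l.2.2 + n)))) := by
  induction ls with
  | nil => exact absurd rfl hl
  | cons a r ih =>
    obtain ⟨k, g, ℓ⟩ := a
    by_cases h : r = []
    · subst h
      exact steps_layer_par_id k g ℓ n
    · rw [List.map_cons, layersToTerm_cons _ _ _ h, layersToTerm_cons _ _ _ (by simpa using h)]
      exact (Step.r9 _ _ _).steps.trans ((steps_layer_par_id k g ℓ n).seq (ih h))

/-- The term represented by an element of `NFRep`. -/
def NFRep.toTerm : NFRep G → PTerm G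
  | .id n => .id n
  | .seq ls => layersToTerm ls

/-- A representation is proper when it is not the empty sequence of layers. -/
def NFRep.Proper : NFRep G → Prop
  | .id _ => True
  | .seq ls => ls ≠ []

theorem NFRep.Proper.bullet {a b : NFRep G} (ha : a.Proper) (hb : b.Proper) :
    (bullet domG codG a b).Proper := by
  match a, b with
  | .id _, .id _ => trivial
  | .id _, .seq _ => exact hb
  | .seq _, .id _ => exact ha
  | .seq _, .seq _ => exact bulletList_ne_nil ha

theorem NFRep.Proper.star {a b : NFRep G} (ha : a.Proper) (hb : b.Proper) :
    (star domG codG a b).Proper := by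
  match a, b with
  | .id _, .id _ => trivial
  | .id _, .seq _ => simpa [_root_.star, NFRep.Proper] using hb
  | .seq _, .id _ => simpa [_root_.star, NFRep.Proper] using ha
  | .seq _, .seq _ =>
    exact List.append_ne_nil_of_right_ne_nil _ (by simpa [NFRep.Proper] using hb)

theorem proper_NFr (t : PTerm G) : (NFr domG codG t).Proper := by
  induction t with
  | id => trivial
  | gen => exact List.cons_ne_nil _ _
  | seq _ _ hu hv => exact hu.bullet hv
  | par _ _ hu hv => exact hu.star hv

theorem steps_bullet {a b : NFRep G} (ha : a.Proper) (hb : b.Proper) :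
    Steps domG codG (.seq a.toTerm b.toTerm) (bullet domG codG a b).toTerm := by
  match a, b with
  | .id _, .id _ => exact (Step.r4 _ _).steps
  | .id _, .seq _ => exact (Step.r3 _ _).steps
  | .seq _, .id _ => exact (Step.r4 _ _).steps
  | .seq _, .seq _ => exact steps_bulletList ha hb

theorem steps_star {a b : NFRep G} (ha : a.Proper) (hb : b.Proper) :
    Steps domG codG (.par a.toTerm b.toTerm) (star domG codG a b).toTerm := by
  match a, b with
  | .id _, .id _ => exact (Step.r5 _ _).steps
  | .id n, .seq _ => exact steps_id_par_layersToTerm n hb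
  | .seq _, .id n => exact steps_layersToTerm_par_id ha n
  | .seq ls, .seq rs =>
    refine (Step.r7 _ _ (layersToTerm_ne_id ha) (layersToTerm_ne_id hb)).steps.trans ?_
    rw [dom_layersToTerm, cod_layersToTerm]
    exact ((steps_layersToTerm_par_id ha _).seq (steps_id_par_layersToTerm _ hb)).trans
      (steps_append (by simpa [NFRep.Proper] using ha) (by simpa [NFRep.Proper] using hb))

theorem NFmap_eq_toTerm (t : PTerm G) : NFmap domG codG t = (NFr domG codG t).toTerm := by
  unfold NFmap NFRep.toTerm
  rfl

end RewritesToNF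

/-- Every preprocessed term rewrites to its normal form. -/
theorem rewrites_to_nf {G : Type} (domG codG : G → ℕ)
    (hSig : ∀ g : G, 0 < domG g ∧ 0 < codG g)
    (t : PTerm G) (ht : PP domG codG t) :
    Steps domG codG t (NFmap domG codG t) := by
  rw [NFmap_eq_toTerm]
  induction ht with
  | id n => exact Steps.refl _
  | layer k g ℓ =>
    simpa [layer, NFr, _root_.star, NFRep.toTerm, layersToTerm] using Steps.refl (layer k g ℓ)
  | seq _ _ _ hu hv => exact (hu.seq hv).trans (steps_bullet (proper_NFr _) (proper_NFr _))
  | par _ _ hu hv => exact (hu.par hv).trans (steps_star (proper_NFr _) (proper_NFr _))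
end

section
/- Rule R7 strictly decreases β: for all terms u, v over Σ, if neither u nor v is an identity id_n, then β(u⊗v) > β((u⊗id_{dom(v)})⨟(id_{cod(u)}⊗v)); numerically, if a = β(u) ≥ 5 and b = β(v) ≥ 5 then a²·b > 4a² + 4b + 1. -/
theorem two_le_beta {G : Type} (t : PTerm G) : 2 ≤ beta t := by
  induction t with
  | id n => simp [beta]
  | gen g => simp [beta]
  | seq u v ihu ihv => simp only [beta]; omega
  | par u v ihu ihv => simp only [beta]; nlinarith [Nat.pow_le_pow_left ihu 2]

theorem five_le_beta {G : Type} (t : PTerm G) (ht : ∀ n : ℕ, t ≠ .id n) : 5 ≤ beta t := by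
  cases t with
  | id n => exact absurd rfl (ht n)
  | gen g => simp [beta]
  | seq u v =>
    have hu := two_le_beta u
    simp only [beta]
    omega
  | par u v =>
    have hu := Nat.pow_le_pow_left (two_le_beta u) 2
    have hv := two_le_beta v
    simp only [beta]
    nlinarith

theorem sq_mul_gt_of_five_le (a b : ℕ) (ha : 5 ≤ a) (hb : 5 ≤ b) :
    a ^ 2 * b > 4 * a ^ 2 + 4 * b + 1 := by
  have h : 25 ≤ a ^ 2 := Nat.pow_le_pow_left ha 2
  nlinarith [Nat.mul_le_mul h hb]

/-- Rule R7 strictly decreases `β`; numerically, `a²b > 4a² + 4b + 1` for `a, b ≥ 5`. -/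
theorem beta_r7 {G : Type} (domG codG : G → ℕ) (u v : PTerm G)
    (hu : ∀ n : ℕ, u ≠ .id n) (hv : ∀ n : ℕ, v ≠ .id n) :
    beta (.par u v) >
      beta (.seq (.par u (.id (v.dom domG))) (.par (.id (u.cod codG)) v) : PTerm G) ∧
    ∀ a b : ℕ, 5 ≤ a → 5 ≤ b → a ^ 2 * b > 4 * a ^ 2 + 4 * b + 1 := by
  have key := sq_mul_gt_of_five_le _ _ (five_le_beta u hu) (five_le_beta v hv)
  refine ⟨?_, sq_mul_gt_of_five_le⟩
  simp only [beta]
  omega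
end
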